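/- Let j ∈ ℤ with j ≥ 1 and n > 0. Then the operator S_{n,j} reproduces the monomial e_j(x) = x^j: Σ_{k=j}^{∞} s_{n,k}(x) · n ∫_0^∞ s_{n,k−j}(t) t^j dt = x^j for all x ≥ 0; in particular (S_{n,j} e_j)(x) = x^j. -/

import Mathlib

open MeasureTheory Real Filter Asymptotics

/-- The basis functions `s_{n,k}(x) = (nx)^k / k! · e^{-nx}` for `k ≥ 0`, and `0` for `k < 0`. -/
noncomputable def szk (n : ℝ) (k : ℤ) (x : ℝ) : ℝ :=
  if k < 0 then 0 else (n * x) ^ k.toNat / (Nat.factorial k.toNat) * Real.exp (-n * x)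

/-- Membership in `E_A`: locally integrable on `[0,∞)` and `|f t| ≤ K e^{A t}` for some `K > 0`. -/
def MemEA (A : ℝ) (f : ℝ → ℝ) : Prop :=
  LocallyIntegrableOn f (Set.Ici 0) volume ∧ ∃ K > 0, ∀ t ≥ (0:ℝ), |f t| ≤ K * Real.exp (A * t)

/-- The Szász-Mirakjan-Durrmeyer type operator `S_{n,j}`. -/
noncomputable def Snj (n : ℝ) (j : ℤ) (f : ℝ → ℝ) (x : ℝ) : ℝ :=
  f 0 * ∑ k ∈ Finset.range j.toNat, szk n k x
    + ∑' k : ℕ, szk n (max 0 j + k) x *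
        (n * ∫ t in Set.Ioi (0:ℝ), szk n (max 0 j + k - j) t * f t)

theorem szk_natCast (n : ℝ) (k : ℕ) (x : ℝ) :
    szk n k x = (n * x) ^ k / (Nat.factorial k) * Real.exp (-n * x) := by
  simp [szk]

theorem integral_szk_mul_pow {n : ℝ} (hn : 0 < n) (k m : ℕ) :
    ∫ t in Set.Ioi (0:ℝ), szk n k t * t ^ m
      = (Nat.factorial (m + k)) / (Nat.factorial k * n ^ (m + 1)) := by
  have hgamma : ∫ t in Set.Ioi (0:ℝ), t ^ (m + k) * Real.exp (-(n * t))
      = (1 / n) ^ (m + k + 1) * (Nat.factorial (m + k)) := by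
    have h := Real.integral_rpow_mul_exp_neg_mul_Ioi (a := ((m + k : ℕ) : ℝ) + 1)
      (by positivity) hn
    rw [Real.Gamma_nat_eq_factorial, add_sub_cancel_right] at h
    simp_rw [Real.rpow_natCast] at h
    rw [h]
    exact_mod_cast rfl
  have hcongr : ∀ t : ℝ, szk n k t * t ^ m
      = n ^ k / (Nat.factorial k) * (t ^ (m + k) * Real.exp (-(n * t))) := by
    intro t
    rw [szk_natCast, neg_mul]
    ring
  simp_rw [hcongr]
  rw [integral_const_mul, hgamma, one_div, inv_pow]
  field_simp
  ring

theorem hasSum_szk (n x : ℝ) : HasSum (fun k : ℕ => szk n k x) 1 := by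
  have h := (NormedSpace.expSeries_div_hasSum_exp (𝔸 := ℝ) (n * x)).mul_right
    (Real.exp (-n * x))
  rw [← Real.exp_eq_exp_ℝ, ← Real.exp_add, neg_mul, add_neg_cancel, Real.exp_zero] at h
  simpa only [szk_natCast, neg_mul] using h

theorem szk_mul_integral_szk_mul_pow {n : ℝ} (hn : 0 < n) (k m : ℕ) (x : ℝ) :
    szk n (m + k) x * (n * ∫ t in Set.Ioi (0:ℝ), szk n k t * t ^ m) = x ^ m * szk n k x := by
  rw [integral_szk_mul_pow hn, ← Nat.cast_add, szk_natCast, szk_natCast]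
  have := Nat.factorial_ne_zero (m + k)
  field_simp
  ring

/-- For `j ≥ 1`, the operator `S_{n,j}` reproduces the monomial `e_j(x) = x^j`. -/
theorem Snj_preserves_ej (j : ℤ) (hj : 1 ≤ j) (n : ℝ) (hn : 0 < n) :
    ∀ x ≥ (0:ℝ),
      (∑' k : ℕ, szk n (j + k) x * (n * ∫ t in Set.Ioi (0:ℝ), szk n k t * t ^ j.toNat))
          = x ^ j.toNat
        ∧ Snj n j (fun t => t ^ j.toNat) x = x ^ j.toNat := by
  intro x _
  lift j to ℕ using by lia with m
  have hm : m ≠ 0 := by lia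
  have hsum : (∑' k : ℕ, szk n (m + k) x * (n * ∫ t in Set.Ioi (0:ℝ), szk n k t * t ^ m))
      = x ^ m := by
    simp_rw [szk_mul_integral_szk_mul_pow hn]
    simpa using ((hasSum_szk n x).mul_left (x ^ m)).tsum_eq
  refine ⟨by simpa only [Int.toNat_natCast] using hsum, ?_⟩
  simp only [Snj, Int.toNat_natCast, zero_pow hm, zero_mul, zero_add,
    max_eq_right (Int.natCast_nonneg m), add_sub_cancel_left]
  exact hsum
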